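/- arXiv:1504.04847 — 2 statements merged into one kernel-verified Lean document; each statement's English description precedes it below -/
import Mathlib

section
/- Let N ≥ 2 and let s, t be real numbers with -∞ < s ≤ t < N, and set α_{N,t} := (N-t)·ω_{N-1}^{1/(N-1)}. Then the constant α_{N,t} is sharp for the weighted Moser–Trudinger inequality: the supremum, over all u ∈ L^N(ℝ^N;|x|^{-s}dx) ∩ Ẇ^{1,N}(ℝ^N) with u not almost everywhere zero and ∫_{ℝ^N}|∇u|^N dx ≤ 1, of the ratio ∫_{ℝ^N} Φ_N(α_{N,t}|u|^{N/(N-1)}) |x|^{-t} dx / (∫_{ℝ^N} |u|^N |x|^{-s} dx)^{(N-t)/(N-s)} is equal to +∞ (hence no uniform constant C exists for any α ≥ α_{N,t}). -/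
open MeasureTheory Real

/-- Surface area of the unit sphere `S^{N-1}` in `ℝ^N`, i.e. `ω_{N-1} = N · vol(B(0,1))`. -/
noncomputable def sphereArea (N : ℕ) : ℝ :=
  N * (volume (Metric.ball (0 : EuclideanSpace ℝ (Fin N)) 1)).toReal

/-- `Φ_N(τ) = Σ_{j ≥ N-1} τ^j / j!`, the exponential series with the first `N-1` terms removed. -/
noncomputable def PhiN (N : ℕ) (τ : ℝ) : ℝ :=
  ∑' j : ℕ, τ ^ (j + (N - 1)) / (Nat.factorial (j + (N - 1)) : ℝ)

/-- `g` is the weak gradient of `u` on `ℝ^N`: both are locally integrable and the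
integration-by-parts identity holds against all smooth compactly supported test functions. -/
def HasWeakGradient {N : ℕ} (u : EuclideanSpace ℝ (Fin N) → ℝ)
    (g : EuclideanSpace ℝ (Fin N) → EuclideanSpace ℝ (Fin N)) : Prop :=
  LocallyIntegrable u volume ∧ LocallyIntegrable g volume ∧
  ∀ φ : EuclideanSpace ℝ (Fin N) → ℝ, ContDiff ℝ (⊤ : ℕ∞) φ → HasCompactSupport φ →
    ∀ i : Fin N,
      ∫ x, u x * fderiv ℝ φ x (EuclideanSpace.single i 1) = - ∫ x, g x i * φ x

/-- A Lipschitz function has its almost everywhere defined gradient as weak gradient. -/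
theorem HasWeakGradient.of_lipschitzWith {N : ℕ} {u : EuclideanSpace ℝ (Fin N) → ℝ}
    {C : NNReal} (hu : LipschitzWith C u) : HasWeakGradient u (gradient u) := by
  have hnorm : ∀ x, ‖gradient u x‖ ≤ C := fun x => by
    rw [gradient, LinearIsometryEquiv.norm_map]
    exact norm_fderiv_le_of_lipschitz ℝ hu
  have hmeas : Measurable (gradient u) :=
    (InnerProductSpace.toDual ℝ _).symm.continuous.measurable.comp (measurable_fderiv ℝ u)
  refine ⟨hu.continuous.locallyIntegrable, ?_, fun φ hφ hφc i => ?_⟩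
  · exact (locallyIntegrable_const (C : ℝ)).mono hmeas.aestronglyMeasurable
      (.of_forall fun x => by simpa using hnorm x)
  · obtain ⟨D, hD⟩ : ∃ D, LipschitzWith D φ :=
      (hφ.of_le (by simp)).lipschitzWith_of_hasCompactSupport hφc one_ne_zero
    have key := hu.integral_lineDeriv_mul_eq (μ := volume) hD hφc (EuclideanSpace.single i 1)
    have hleft : ∫ x, lineDeriv ℝ u x (EuclideanSpace.single i 1) * φ x =
        ∫ x, gradient u x i * φ x := by
      refine integral_congr_ae ?_
      filter_upwards [hu.ae_differentiableAt (μ := volume)] with x hx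
      have : gradient u x i = fderiv ℝ u x (EuclideanSpace.single i 1) := by
        rw [← InnerProductSpace.toDual_symm_apply (𝕜 := ℝ), EuclideanSpace.inner_single_right]
        simp [gradient]
      simp only [hx.lineDeriv_eq_fderiv, this]
    have hright : ∀ x, lineDeriv ℝ φ x (-EuclideanSpace.single i 1) * u x =
        -(u x * fderiv ℝ φ x (EuclideanSpace.single i 1)) := fun x => by
      rw [(hφ.differentiable (by simp) x).lineDeriv_eq_fderiv, map_neg]
      ring
    rw [hleft] at key
    simp only [hright, integral_neg] at key
    rw [key, neg_neg]

theorem sphereArea_pos {N : ℕ} (hN : N ≠ 0) : 0 < sphereArea N := by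
  have : 0 < (N : ℝ) := by positivity
  exact mul_pos this (ENNReal.toReal_pos (Metric.measure_ball_pos _ _ one_pos).ne'
    measure_ball_lt_top.ne)

/-- Integration of a radial function over an annulus in polar coordinates. -/
theorem lintegral_indicator_Ioo_norm {N : ℕ} (hN : N ≠ 0) {a b : ℝ} (ha : 0 ≤ a)
    {f : ℝ → ℝ} (hf : ∀ r ∈ Set.Ioo a b, 0 ≤ f r)
    (hint : IntegrableOn (fun r => r ^ (N - 1) * f r) (Set.Ioo a b)) :
    ∫⁻ x : EuclideanSpace ℝ (Fin N), ENNReal.ofReal ((Set.Ioo a b).indicator f ‖x‖) =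
      ENNReal.ofReal (sphereArea N * ∫ r in Set.Ioo a b, r ^ (N - 1) * f r) := by
  have : NeZero N := ⟨hN⟩
  have hsub : Set.Ioo a b ⊆ Set.Ioi 0 := fun r hr => ha.trans_lt hr.1
  have hmul : (fun r : ℝ => r ^ (N - 1) • (Set.Ioo a b).indicator f r) =
      (Set.Ioo a b).indicator fun r => r ^ (N - 1) * f r := by
    ext r
    by_cases hr : r ∈ Set.Ioo a b <;> simp [hr]
  have hI : Integrable fun x : EuclideanSpace ℝ (Fin N) => (Set.Ioo a b).indicator f ‖x‖ := by
    rw [integrable_fun_norm_addHaar, finrank_euclideanSpace_fin, hmul]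
    exact (hint.integrable_indicator measurableSet_Ioo).integrableOn
  rw [← ofReal_integral_eq_lintegral_ofReal hI
      (.of_forall fun x => Set.indicator_nonneg hf _), integral_fun_norm_addHaar,
    finrank_euclideanSpace_fin, hmul, setIntegral_indicator measurableSet_Ioo,
    Set.inter_eq_right.2 hsub]
  simp [sphereArea, Measure.real, mul_assoc]

theorem lintegral_indicator_Ioo_norm_rpow {N : ℕ} (hN : N ≠ 0) {b p : ℝ} (hb : 0 ≤ b)
    (hp : 0 < N + p) :
    ∫⁻ x : EuclideanSpace ℝ (Fin N), ENNReal.ofReal ((Set.Ioo 0 b).indicator (· ^ p) ‖x‖) =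
      ENNReal.ofReal (sphereArea N * (b ^ (N + p) / (N + p))) := by
  have hpow : ∀ r ∈ Set.Ioo 0 b, r ^ (N - 1) * r ^ p = r ^ (N + p - 1) := fun r hr => by
    rw [← Real.rpow_natCast, ← Real.rpow_add hr.1,
      Nat.cast_sub (Nat.one_le_iff_ne_zero.2 hN)]
    congr 1
    push_cast
    ring
  have hint : IntervalIntegrable (fun r : ℝ => r ^ (N + p - 1)) volume 0 b :=
    intervalIntegral.intervalIntegrable_rpow' (by linarith)
  rw [lintegral_indicator_Ioo_norm hN le_rfl fun r hr => rpow_nonneg hr.1.le _]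
  · rw [setIntegral_congr_fun measurableSet_Ioo hpow, ← integral_Ioc_eq_integral_Ioo,
      ← intervalIntegral.integral_of_le hb, integral_rpow (.inl (by linarith))]
    simp [Real.zero_rpow hp.ne']
  · refine (integrableOn_congr_fun hpow measurableSet_Ioo).2 ?_
    exact ((intervalIntegrable_iff_integrableOn_Ioc_of_le hb).1 hint).mono_set
      Set.Ioo_subset_Ioc_self

theorem lintegral_indicator_Ioo_norm_inv_pow {N : ℕ} (hN : N ≠ 0) {a : ℝ} (ha : 0 < a)
    (ha1 : a ≤ 1) (c : ℝ) (hc : 0 ≤ c) :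
    ∫⁻ x : EuclideanSpace ℝ (Fin N),
      ENNReal.ofReal ((Set.Ioo a 1).indicator (fun r => (c * r⁻¹) ^ N) ‖x‖) =
      ENNReal.ofReal (sphereArea N * (c ^ N * -log a)) := by
  have hpow : ∀ r ∈ Set.Ioo a 1, r ^ (N - 1) * (c * r⁻¹) ^ N = c ^ N * r⁻¹ := fun r hr => by
    have hr0 : r ≠ 0 := (ha.trans hr.1).ne'
    obtain ⟨n, rfl⟩ := Nat.exists_eq_succ_of_ne_zero hN
    simp only [Nat.succ_eq_add_one, Nat.add_sub_cancel, mul_pow, inv_pow]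
    field_simp
    ring
  have hint : IntervalIntegrable (fun r : ℝ => c ^ N * r⁻¹) volume a 1 := by
    refine (intervalIntegrable_inv_iff.2 (.inr ?_)).const_mul _
    rw [Set.uIcc_of_le ha1]
    exact fun h => ha.not_ge h.1
  rw [lintegral_indicator_Ioo_norm hN ha.le fun r hr =>
    pow_nonneg (mul_nonneg hc (inv_nonneg.2 (ha.trans hr.1).le)) _]
  · rw [setIntegral_congr_fun measurableSet_Ioo hpow, ← integral_Ioc_eq_integral_Ioo,
      ← intervalIntegral.integral_of_le ha1, intervalIntegral.integral_const_mul,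
      integral_inv_of_pos ha one_pos, one_div, Real.log_inv]
  · refine (integrableOn_congr_fun hpow measurableSet_Ioo).2 ?_
    exact ((intervalIntegrable_iff_integrableOn_Ioc_of_le ha1).1 hint).mono_set
      Set.Ioo_subset_Ioc_self

theorem PhiN_eq_exp_sub (N : ℕ) (τ : ℝ) :
    PhiN N τ = exp τ - ∑ j ∈ Finset.range (N - 1), τ ^ j / (Nat.factorial j : ℝ) := by
  rw [PhiN, Real.exp_eq_exp_ℝ, NormedSpace.exp_eq_tsum_div]
  simp only
  rw [← (Real.summable_pow_div_factorial τ).sum_add_tsum_nat_add (N - 1)]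
  ring

theorem PhiN_nonneg (N : ℕ) {τ : ℝ} (hτ : 0 ≤ τ) : 0 ≤ PhiN N τ :=
  tsum_nonneg fun _ => by positivity

theorem tendsto_exp_neg_mul_PhiN (N : ℕ) :
    Filter.Tendsto (fun τ => exp (-τ) * PhiN N τ) Filter.atTop (nhds 1) := by
  have h : Filter.Tendsto (fun τ : ℝ => ∑ j ∈ Finset.range (N - 1),
      τ ^ j * exp (-τ) / (Nat.factorial j : ℝ)) Filter.atTop (nhds 0) := by
    simpa using tendsto_finsetSum (Finset.range (N - 1)) fun j _ =>
      (Real.tendsto_pow_mul_exp_neg_atTop_nhds_zero j).div_const (Nat.factorial j : ℝ)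
  have h' := h.const_sub 1
  rw [sub_zero] at h'
  refine h'.congr fun τ => ?_
  rw [PhiN_eq_exp_sub, mul_sub, ← Real.exp_add, neg_add_cancel, Real.exp_zero, Finset.mul_sum]
  exact congrArg _ (Finset.sum_congr rfl fun j _ => by ring)

/-- The function `r ↦ log (1/r)`, truncated to take values in `[0, L]`. -/
noncomputable def truncNegLog (L r : ℝ) : ℝ :=
  -log (max (exp (-L)) (min 1 r))

theorem truncNegLog_of_le {L r : ℝ} (hL : 0 ≤ L) (hr : r ≤ exp (-L)) : truncNegLog L r = L := by
  have h1 : exp (-L) ≤ 1 := Real.exp_le_one_iff.2 (by linarith)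
  rw [truncNegLog, min_eq_right (hr.trans h1), max_eq_left hr, Real.log_exp, neg_neg]

theorem truncNegLog_of_one_le {L r : ℝ} (hL : 0 ≤ L) (hr : 1 ≤ r) : truncNegLog L r = 0 := by
  rw [truncNegLog, min_eq_left hr, max_eq_right (Real.exp_le_one_iff.2 (by linarith)),
    Real.log_one, neg_zero]

theorem truncNegLog_of_mem_Icc {L r : ℝ} (hr : r ∈ Set.Icc (exp (-L)) 1) :
    truncNegLog L r = -log r := by
  rw [truncNegLog, min_eq_right hr.2, max_eq_right hr.1]

theorem truncNegLog_nonneg {L r : ℝ} (hL : 0 ≤ L) : 0 ≤ truncNegLog L r := by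
  refine neg_nonneg.2 (Real.log_nonpos ((exp_pos _).le.trans (le_max_left _ _)) ?_)
  exact max_le (Real.exp_le_one_iff.2 (by linarith)) (min_le_left _ _)

theorem truncNegLog_le_neg_log {L r : ℝ} (hr : 0 < r) (hr1 : r ≤ 1) :
    truncNegLog L r ≤ -log r := by
  refine neg_le_neg (Real.log_le_log hr ?_)
  rw [min_eq_right hr1]
  exact le_max_right _ _

theorem abs_log_sub_log_le {L a b : ℝ} (ha : exp (-L) ≤ a) (hb : exp (-L) ≤ b) :
    |log a - log b| ≤ exp L * |a - b| := by
  have key : ∀ {a b : ℝ}, exp (-L) ≤ a → exp (-L) ≤ b → log a - log b ≤ exp L * |a - b| := by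
    intro a b ha hb
    have ha0 := (exp_pos _).trans_le ha
    have hb0 := (exp_pos _).trans_le hb
    rw [← Real.log_div ha0.ne' hb0.ne']
    have hinv : b⁻¹ ≤ exp L := by
      rw [← inv_inv (exp L), ← Real.exp_neg]
      exact inv_anti₀ (exp_pos _) hb
    calc log (a / b) ≤ a / b - 1 := Real.log_le_sub_one_of_pos (div_pos ha0 hb0)
      _ = b⁻¹ * (a - b) := by field_simp
      _ ≤ b⁻¹ * |a - b| := by gcongr; exact le_abs_self _
      _ ≤ exp L * |a - b| := by gcongr
  rw [abs_le]
  refine ⟨?_, key ha hb⟩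
  have := key hb ha
  rw [abs_sub_comm] at this
  linarith

theorem lipschitzWith_truncNegLog (L : ℝ) : LipschitzWith (exp L).toNNReal (truncNegLog L) := by
  refine LipschitzWith.of_dist_le_mul fun r r' => ?_
  rw [Real.coe_toNNReal _ (exp_pos _).le, Real.dist_eq, Real.dist_eq, truncNegLog, truncNegLog,
    neg_sub_neg]
  refine (abs_log_sub_log_le (le_max_left _ _) (le_max_left _ _)).trans ?_
  refine mul_le_mul_of_nonneg_left ?_ (exp_pos _).le
  rw [abs_sub_comm]
  refine (abs_max_sub_max_le_max _ _ _ _).trans ?_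
  rw [sub_self, abs_zero, max_eq_right (abs_nonneg _)]
  refine (abs_min_sub_min_le_max _ _ _ _).trans ?_
  rw [sub_self, abs_zero, max_eq_right (abs_nonneg _)]

/-- Moser's extremal function, with amplitude `c` and truncation parameter `L`. -/
noncomputable def moserFun (N : ℕ) (c L : ℝ) (x : EuclideanSpace ℝ (Fin N)) : ℝ :=
  c * truncNegLog L ‖x‖

theorem lipschitzWith_moserFun (N : ℕ) (c L : ℝ) :
    LipschitzWith (‖c‖₊ * ((exp L).toNNReal * 1)) (moserFun N c L) :=
  (lipschitzWith_smul c).comp ((lipschitzWith_truncNegLog L).comp lipschitzWith_one_norm)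

theorem norm_gradient_moserFun_le {N : ℕ} {c L : ℝ} (hc : 0 ≤ c) (hL : 0 ≤ L)
    {x : EuclideanSpace ℝ (Fin N)} (hx1 : ‖x‖ ≠ 1) (hxL : ‖x‖ ≠ exp (-L)) :
    ‖gradient (moserFun N c L) x‖ ≤
      (Set.Ioo (exp (-L)) 1).indicator (fun r => c * r⁻¹) ‖x‖ := by
  rw [gradient, LinearIsometryEquiv.norm_map]
  rcases hxL.lt_or_gt with hlt | hgt
  · have heq : moserFun N c L =ᶠ[nhds x] fun _ => c * L := by
      filter_upwards [(isOpen_lt continuous_norm continuous_const).mem_nhds hlt] with y hy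
      rw [moserFun, truncNegLog_of_le hL (le_of_lt hy)]
    simp [heq.fderiv_eq, not_lt.2 hlt.le]
  rcases hx1.lt_or_gt with hlt1 | hgt1
  · have hx0 : x ≠ 0 := norm_pos_iff.1 ((exp_pos _).trans hgt)
    have heq : moserFun N c L =ᶠ[nhds x] fun y => -c * log ‖y‖ := by
      filter_upwards [(isOpen_lt continuous_norm continuous_const).mem_nhds hlt1,
        (isOpen_lt continuous_const continuous_norm).mem_nhds hgt] with y hy hy'
      rw [moserFun, truncNegLog_of_mem_Icc ⟨le_of_lt hy', le_of_lt hy⟩]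
      ring
    have hd : HasFDerivAt (fun y : EuclideanSpace ℝ (Fin N) => -c * log ‖y‖)
        (-c • ‖x‖⁻¹ • fderiv ℝ (‖·‖) x) x :=
      (((differentiableAt_id.norm ℝ hx0).hasFDerivAt).log (norm_ne_zero_iff.2 hx0)).const_mul _
    have hn : ‖fderiv ℝ (fun y : EuclideanSpace ℝ (Fin N) => ‖y‖) x‖ ≤ 1 := by
      simpa using norm_fderiv_le_of_lipschitz ℝ lipschitzWith_one_norm (x₀ := x)
    rw [heq.fderiv_eq, hd.fderiv, Set.indicator_of_mem (Set.mem_Ioo.2 ⟨hgt, hlt1⟩), norm_smul,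
      norm_smul, norm_neg, Real.norm_of_nonneg hc, norm_inv, norm_norm]
    gcongr
    exact mul_le_of_le_one_right (by positivity) hn
  · have heq : moserFun N c L =ᶠ[nhds x] fun _ => 0 := by
      filter_upwards [(isOpen_lt continuous_const continuous_norm).mem_nhds hgt1] with y hy
      rw [moserFun, truncNegLog_of_one_le hL (le_of_lt hy), mul_zero]
    simp [heq.fderiv_eq, not_lt.2 hgt1.le]

theorem lintegral_norm_gradient_moserFun_le {N : ℕ} (hN : N ≠ 0) {c L : ℝ} (hc : 0 ≤ c)
    (hL : 0 ≤ L) :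
    ∫⁻ x, ENNReal.ofReal (‖gradient (moserFun N c L) x‖ ^ (N : ℝ)) ≤
      ENNReal.ofReal (sphereArea N * (c ^ N * L)) := by
  have : NeZero N := ⟨hN⟩
  have hmain := lintegral_indicator_Ioo_norm_inv_pow hN (exp_pos (-L))
    (Real.exp_le_one_iff.2 (by linarith)) c hc
  rw [Real.log_exp, neg_neg] at hmain
  rw [← hmain]
  have hsphere : ∀ r : ℝ, ∀ᵐ x : EuclideanSpace ℝ (Fin N), ‖x‖ ≠ r := fun r => by
    rw [ae_iff]
    convert Measure.addHaar_sphere volume (0 : EuclideanSpace ℝ (Fin N)) r using 2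
    ext x
    simp
  refine lintegral_mono_ae ?_
  filter_upwards [hsphere 1, hsphere (exp (-L))] with x hx1 hxL
  refine ENNReal.ofReal_le_ofReal ?_
  rw [Real.rpow_natCast]
  refine (pow_le_pow_left₀ (norm_nonneg _) (norm_gradient_moserFun_le hc hL hx1 hxL) N).trans ?_
  by_cases h : ‖x‖ ∈ Set.Ioo (exp (-L)) 1
  · rw [Set.indicator_of_mem h, Set.indicator_of_mem h]
  · rw [Set.indicator_of_notMem h, Set.indicator_of_notMem h, zero_pow hN]

theorem exists_lintegral_moserFun_le {N : ℕ} (hN : N ≠ 0) {s : ℝ} (hs : s < N) :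
    ∃ K : ℝ, ∀ c L : ℝ, 0 ≤ c → 0 ≤ L →
      ∫⁻ x, ENNReal.ofReal (|moserFun N c L x| ^ (N : ℝ) * ‖x‖ ^ (-s)) ≤
        ENNReal.ofReal (c ^ N * K) := by
  have : NeZero N := ⟨hN⟩
  have hN0 : (0 : ℝ) < N := by positivity
  set ε : ℝ := (N - s) / (2 * N) with hε_def
  have hε : 0 < ε := div_pos (by linarith) (by linarith)
  have hεN : ε * N = (N - s) / 2 := by
    rw [hε_def]
    field_simp
  set p : ℝ := -(ε * N) - s with hp_def
  have hp : 0 < N + p := by rw [hp_def, hεN]; linarith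
  refine ⟨ε⁻¹ ^ N * (sphereArea N * (1 ^ (N + p) / (N + p))), fun c L hc hL => ?_⟩
  have hbound : ∀ᵐ x : EuclideanSpace ℝ (Fin N),
      ENNReal.ofReal (|moserFun N c L x| ^ (N : ℝ) * ‖x‖ ^ (-s)) ≤
        ENNReal.ofReal (c ^ N * ε⁻¹ ^ N) *
          ENNReal.ofReal ((Set.Ioo 0 1).indicator (· ^ p) ‖x‖) := by
    filter_upwards [Measure.ae_ne volume (0 : EuclideanSpace ℝ (Fin N))] with x hx
    have hx0 : 0 < ‖x‖ := norm_pos_iff.2 hx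
    rw [← ENNReal.ofReal_mul (by positivity)]
    refine ENNReal.ofReal_le_ofReal ?_
    rw [Real.rpow_natCast, moserFun, abs_mul, abs_of_nonneg hc,
      abs_of_nonneg (truncNegLog_nonneg hL)]
    rcases lt_or_ge ‖x‖ 1 with hx1 | hx1
    · have hlog : truncNegLog L ‖x‖ ≤ ε⁻¹ * ‖x‖ ^ (-ε) := by
        refine (truncNegLog_le_neg_log hx0 hx1.le).trans ?_
        rw [← Real.log_inv, Real.rpow_neg hx0.le, ← Real.inv_rpow hx0.le, inv_mul_eq_div]
        exact Real.log_le_rpow_div (inv_nonneg.2 hx0.le) hε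
      have hpow : (‖x‖ ^ (-ε)) ^ N * ‖x‖ ^ (-s) = ‖x‖ ^ p := by
        rw [← Real.rpow_natCast, ← Real.rpow_mul hx0.le, ← Real.rpow_add hx0, hp_def]
        congr 1
        ring
      rw [Set.indicator_of_mem (Set.mem_Ioo.2 ⟨hx0, hx1⟩), ← hpow]
      calc (c * truncNegLog L ‖x‖) ^ N * ‖x‖ ^ (-s)
          ≤ (c * (ε⁻¹ * ‖x‖ ^ (-ε))) ^ N * ‖x‖ ^ (-s) := by
            have := truncNegLog_nonneg (r := ‖x‖) hL
            gcongr
        _ = c ^ N * ε⁻¹ ^ N * ((‖x‖ ^ (-ε)) ^ N * ‖x‖ ^ (-s)) := by ring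
    · rw [truncNegLog_of_one_le hL hx1, mul_zero, zero_pow hN, zero_mul]
      exact mul_nonneg (by positivity) (Set.indicator_nonneg (fun r hr => rpow_nonneg hr.1.le _) _)
  refine (lintegral_mono_ae hbound).trans ?_
  rw [lintegral_const_mul' _ _ ENNReal.ofReal_ne_top,
    lintegral_indicator_Ioo_norm_rpow hN zero_le_one hp,
    ← ENNReal.ofReal_mul (by positivity), mul_assoc]

theorem le_lintegral_PhiN_moserFun {N : ℕ} (hN : N ≠ 0) {t : ℝ} (ht : t < N) {β q c L : ℝ}
    (hβ : 0 ≤ β) (hc : 0 ≤ c) (hL : 0 ≤ L) :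
    ENNReal.ofReal (sphereArea N / (N - t) *
        (exp (-((N - t) * L)) * PhiN N (β * (c * L) ^ q))) ≤
      ∫⁻ x, ENNReal.ofReal (PhiN N (β * |moserFun N c L x| ^ q) * ‖x‖ ^ (-t)) := by
  have hΦ : 0 ≤ PhiN N (β * (c * L) ^ q) := PhiN_nonneg N (by positivity)
  have hp : (0 : ℝ) < N + -t := by linarith
  calc _ = ENNReal.ofReal (PhiN N (β * (c * L) ^ q)) *
        ∫⁻ x : EuclideanSpace ℝ (Fin N),
          ENNReal.ofReal ((Set.Ioo 0 (exp (-L))).indicator (· ^ (-t)) ‖x‖) := by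
        rw [lintegral_indicator_Ioo_norm_rpow hN (exp_pos _).le hp, ← ENNReal.ofReal_mul hΦ,
          ← Real.exp_mul, ← sub_eq_add_neg, show -((N - t) * L) = -L * (N - t) by ring]
        congr 1
        ring
    _ ≤ _ := by
        rw [← lintegral_const_mul' _ _ ENNReal.ofReal_ne_top]
        refine lintegral_mono fun x => ?_
        rw [← ENNReal.ofReal_mul hΦ]
        refine ENNReal.ofReal_le_ofReal ?_
        by_cases h : ‖x‖ ∈ Set.Ioo 0 (exp (-L))
        · rw [Set.indicator_of_mem h, moserFun, truncNegLog_of_le hL h.2.le,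
            abs_of_nonneg (by positivity)]
        · rw [Set.indicator_of_notMem h, mul_zero]
          exact mul_nonneg (PhiN_nonneg N (by positivity)) (by positivity)

theorem not_moserFun_ae_eq_zero {N : ℕ} {c L : ℝ} (hc : 0 < c) (hL : 0 < L) :
    ¬ moserFun N c L =ᵐ[volume] fun _ => (0 : ℝ) := by
  intro h
  have h0 := congrFun ((lipschitzWith_moserFun N c L).continuous.ae_eq_iff_eq volume
    continuous_const |>.1 h) 0
  rw [moserFun, norm_zero, truncNegLog_of_le hL.le (exp_pos _).le] at h0
  exact (mul_pos hc hL).ne h0.symm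

/-- **Sharpness of `α_{N,t}` in the weighted Moser–Trudinger inequality (Theorem 1.1).**
At `α = α_{N,t} = (N-t)·ω_{N-1}^{1/(N-1)}` the supremum of the ratio
`∫ Φ_N(α_{N,t}|u|^{N/(N-1)})|x|^{-t} dx / (∫ |u|^N |x|^{-s} dx)^{(N-t)/(N-s)}`
over admissible `u` (not a.e. zero, `∫|∇u|^N ≤ 1`) is `+∞`. -/
theorem weighted_moser_trudinger_PhiN_sharp (N : ℕ) (hN : 2 ≤ N) (s t : ℝ) (hst : s ≤ t)
    (htN : t < (N : ℝ)) :
    (⨆ (u : EuclideanSpace ℝ (Fin N) → ℝ)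
       (g : EuclideanSpace ℝ (Fin N) → EuclideanSpace ℝ (Fin N))
       (_ : HasWeakGradient u g ∧ ¬ (u =ᵐ[volume] fun _ => (0 : ℝ)) ∧
            (∫⁻ x, ENNReal.ofReal (|u x| ^ (N : ℝ) * ‖x‖ ^ (-s))) ≠ ⊤ ∧
            (∫⁻ x, ENNReal.ofReal (‖g x‖ ^ (N : ℝ))) ≤ 1),
      (∫⁻ x, ENNReal.ofReal
          (PhiN N ((((N : ℝ) - t) * sphereArea N ^ (1 / ((N : ℝ) - 1))) *
            |u x| ^ ((N : ℝ) / ((N : ℝ) - 1))) * ‖x‖ ^ (-t))) /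
        (∫⁻ x, ENNReal.ofReal (|u x| ^ (N : ℝ) * ‖x‖ ^ (-s))) ^
          (((N : ℝ) - t) / ((N : ℝ) - s))) = ⊤ := by
  have hN0 : N ≠ 0 := by omega
  have hNR : (2 : ℝ) ≤ N := by exact_mod_cast hN
  set ω := sphereArea N with hω_def
  have hω : 0 < ω := sphereArea_pos hN0
  have hsN : s < N := hst.trans_lt htN
  have hp : 0 < ((N : ℝ) - t) / ((N : ℝ) - s) := div_pos (by linarith) (by linarith)
  set p := ((N : ℝ) - t) / ((N : ℝ) - s)
  obtain ⟨K, hK⟩ := exists_lintegral_moserFun_le hN0 hsN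
  set c : ℝ → ℝ := fun L => (ω * L) ^ (-(1 / (N : ℝ))) with hc_def
  have hcpos : ∀ L, 0 < L → 0 < c L := fun L hL => rpow_pos_of_pos (mul_pos hω hL) _
  have hcN : ∀ L, 0 < L → c L ^ N = (ω * L)⁻¹ := fun L hL => by
    rw [hc_def, ← Real.rpow_natCast, ← Real.rpow_mul (mul_pos hω hL).le,
      show -(1 / (N : ℝ)) * N = -1 by field_simp, Real.rpow_neg_one]
  have hexp : ∀ L, 0 < L → ((N : ℝ) - t) * ω ^ (1 / ((N : ℝ) - 1)) *
      (c L * L) ^ ((N : ℝ) / ((N : ℝ) - 1)) = ((N : ℝ) - t) * L := fun L hL => by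
    have hN1 : (N : ℝ) - 1 ≠ 0 := by linarith
    rw [Real.mul_rpow (hcpos L hL).le hL.le, hc_def, ← Real.rpow_mul (mul_pos hω hL).le,
      show -(1 / (N : ℝ)) * (N / (N - 1)) = -(1 / ((N : ℝ) - 1)) by field_simp,
      Real.mul_rpow hω.le hL.le, mul_assoc, mul_assoc, ← mul_assoc (ω ^ _),
      ← Real.rpow_add hω, add_neg_cancel, Real.rpow_zero, one_mul, ← Real.rpow_add hL,
      show -(1 / ((N : ℝ) - 1)) + N / (N - 1) = 1 by field_simp; ring, Real.rpow_one]
  have hnum : ∀ᶠ L : ℝ in Filter.atTop,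
      1 / 2 ≤ exp (-(((N : ℝ) - t) * L)) * PhiN N (((N : ℝ) - t) * L) :=
    ((tendsto_exp_neg_mul_PhiN N).comp (Filter.tendsto_id.const_mul_atTop
      (sub_pos.2 htN))).eventually_const_le (by norm_num)
  have hden : Filter.Tendsto (fun L : ℝ => ENNReal.ofReal ((ω * L)⁻¹ * K) ^ p)
      Filter.atTop (nhds 0) := by
    have h1 : Filter.Tendsto (fun L : ℝ => (ω * L)⁻¹ * K) Filter.atTop (nhds 0) := by
      simpa using (tendsto_inv_atTop_zero.comp
        (Filter.tendsto_id.const_mul_atTop hω)).mul_const K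
    have h2 := (ENNReal.continuous_rpow_const (y := p)).tendsto _ |>.comp
      ((ENNReal.continuous_ofReal.tendsto _).comp h1)
    rwa [ENNReal.ofReal_zero, ENNReal.zero_rpow_of_pos hp] at h2
  have hA : ENNReal.ofReal (ω / (N - t) * (1 / 2)) ≠ 0 := by
    have : 0 < ω / (N - t) := div_pos hω (sub_pos.2 htN)
    exact (ENNReal.ofReal_pos.2 (by positivity)).ne'
  have hlim := ENNReal.Tendsto.const_div hden
    (.inr (ENNReal.ofReal_ne_top (r := ω / (N - t) * (1 / 2))))
  rw [ENNReal.div_zero hA] at hlim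
  refine top_le_iff.1 (le_of_tendsto hlim ?_)
  filter_upwards [hnum, Filter.eventually_gt_atTop 0] with L hLnum hL
  have hc := hcpos L hL
  have hdenL := hK (c L) L hc.le hL.le
  rw [hcN L hL] at hdenL
  refine le_iSup_of_le (moserFun N (c L) L) <| le_iSup_of_le (gradient (moserFun N (c L) L)) <|
    le_iSup_of_le ⟨.of_lipschitzWith (lipschitzWith_moserFun N _ _),
      not_moserFun_ae_eq_zero hc hL, (hdenL.trans_lt ENNReal.ofReal_lt_top).ne, ?_⟩ <|
    ENNReal.div_le_div ?_ (ENNReal.rpow_le_rpow hdenL hp.le)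
  · refine (lintegral_norm_gradient_moserFun_le hN0 hc.le hL.le).trans ?_
    rw [hcN L hL, ← ENNReal.ofReal_one]
    refine ENNReal.ofReal_le_ofReal (le_of_eq ?_)
    rw [← hω_def]
    field_simp
  · have hβ : 0 ≤ ((N : ℝ) - t) * ω ^ (1 / ((N : ℝ) - 1)) :=
      mul_nonneg (by linarith) (by positivity)
    refine le_trans (ENNReal.ofReal_le_ofReal ?_)
      (le_lintegral_PhiN_moserFun hN0 htN hβ hc.le hL.le)
    rw [hexp L hL]
    exact mul_le_mul_of_nonneg_left hLnum (div_nonneg hω.le (by linarith))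
end

section
/- Let N ≥ 2 and let 0 < α < α_N := N·ω_{N-1}^{1/(N-1)}. Then there exists a constant C_α > 0 depending only on N and α such that for every function u ∈ W^{1,N}(ℝ^N) with ∫_{ℝ^N}|∇u|^N dx ≤ 1, one has ∫_{ℝ^N} e^{α|u(x)|^{N/(N-1)}} |u(x)|^N dx ≤ C_α ∫_{ℝ^N} |u(x)|^N dx. -/
open MeasureTheory Real

section Polar

open Set Metric

theorem enorm_le_enorm_add_lintegral_enorm_fderiv {E : Type*} [NormedAddCommGroup E]
    [NormedSpace ℝ E] {v : E → ℝ} (hv : ContDiff ℝ 1 v) (x θ : E) (hθ : ‖θ‖ = 1)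
    {r R : ℝ} (hr : r ∈ Ioo 0 R) :
    ‖v x‖ₑ ≤ ‖v (x + r • θ)‖ₑ + ∫⁻ s in Ioo 0 R, ‖fderiv ℝ v (x + s • θ)‖ₑ := by
  have hd : ∀ s : ℝ, HasDerivAt (fun s : ℝ => v (x + s • θ)) (fderiv ℝ v (x + s • θ) θ) s := by
    intro s
    have h1 : HasDerivAt (fun s : ℝ => x + s • θ) θ s := by
      simpa using ((hasDerivAt_id s).smul_const θ).const_add x
    exact ((hv.differentiable one_ne_zero) _).hasFDerivAt.comp_hasDerivAt s h1
  have hc : Continuous fun s : ℝ => fderiv ℝ v (x + s • θ) θ := by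
    have := hv.continuous_fderiv one_ne_zero
    fun_prop
  have h2 := intervalIntegral.integral_eq_sub_of_hasDerivAt (a := 0) (b := r)
    (fun s _ => hd s) (hc.intervalIntegrable _ _)
  have h3 : v x = v (x + r • θ) - ∫ s in (0 : ℝ)..r, fderiv ℝ v (x + s • θ) θ := by
    rw [h2]; simp
  rw [h3]
  refine enorm_sub_le.trans (add_le_add le_rfl ?_)
  rw [intervalIntegral.integral_of_le hr.1.le]
  refine (enorm_integral_le_lintegral_enorm _).trans ?_
  refine (lintegral_mono fun s => ?_).trans
    (lintegral_mono_set (fun s hs => ⟨hs.1, hs.2.trans_lt hr.2⟩))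
  refine ((fderiv ℝ v (x + s • θ)).le_opENorm θ).trans ?_
  simp [← ofReal_norm, hθ]

variable {E : Type*} [NormedAddCommGroup E] [NormedSpace ℝ E] [FiniteDimensional ℝ E]
  [Nontrivial E] [MeasurableSpace E] [BorelSpace E]

theorem lintegral_eq_lintegral_sphere_Ioi (μ : Measure E) [μ.IsAddHaarMeasure]
    {F : E → ENNReal} (hF : Measurable F) :
    ∫⁻ x, F x ∂μ = ∫⁻ θ, (∫⁻ r in Ioi (0 : ℝ),
      ENNReal.ofReal (r ^ (Module.finrank ℝ E - 1)) * F (r • (θ : E))) ∂μ.toSphere := by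
  have h1 := μ.measurePreserving_homeomorphUnitSphereProd.symm
    (homeomorphUnitSphereProd E).toMeasurableEquiv |>.lintegral_comp
      (f := fun x : ({0}ᶜ : Set E) => F x) (hF.comp measurable_subtype_coe)
  have h2 : ∫⁻ x, F x ∂μ = ∫⁻ x : ({0}ᶜ : Set E), F x ∂(μ.comap (↑)) := by
    rw [lintegral_subtype_comap (measurableSet_singleton _).compl, restrict_compl_singleton]
  rw [h2, ← h1, lintegral_prod]
  · refine lintegral_congr fun θ => ?_
    rw [Measure.volumeIoiPow, lintegral_withDensity_eq_lintegral_mul]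
    · rw [← lintegral_subtype_comap measurableSet_Ioi]
      rfl
    · fun_prop
    · refine hF.comp ?_
      exact (measurable_subtype_coe.comp
        (homeomorphUnitSphereProd E).symm.continuous.measurable).comp measurable_prodMk_left
  · refine (hF.comp ?_).aemeasurable
    exact (measurable_subtype_coe.comp
        (homeomorphUnitSphereProd E).symm.continuous.measurable)

theorem setLIntegral_ball_eq_lintegral_sphere (μ : Measure E) [μ.IsAddHaarMeasure]
    {F : E → ENNReal} (hF : Measurable F) (R : ℝ) :
    ∫⁻ x in ball 0 R, F x ∂μ = ∫⁻ θ, (∫⁻ r in Ioo (0 : ℝ) R,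
      ENNReal.ofReal (r ^ (Module.finrank ℝ E - 1)) * F (r • (θ : E))) ∂μ.toSphere := by
  rw [← lintegral_indicator measurableSet_ball,
    lintegral_eq_lintegral_sphere_Ioi μ (hF.indicator measurableSet_ball)]
  refine lintegral_congr fun θ => ?_
  rw [← lintegral_indicator measurableSet_Ioi, ← lintegral_indicator measurableSet_Ioo]
  refine lintegral_congr fun r => ?_
  by_cases h0 : 0 < r
  · by_cases hR : r < R <;> simp [indicator, h0, hR, norm_smul, abs_of_pos h0]
  · simp [indicator, h0]

theorem setLIntegral_ball_mul_inv_norm_pow (μ : Measure E) [μ.IsAddHaarMeasure]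
    {F : E → ENNReal} (hF : Measurable F) (R : ℝ) :
    ∫⁻ x in ball 0 R, F x * (ENNReal.ofReal (‖x‖ ^ (Module.finrank ℝ E - 1)))⁻¹ ∂μ =
      ∫⁻ θ, (∫⁻ r in Ioo (0 : ℝ) R, F (r • (θ : E))) ∂μ.toSphere := by
  rw [setLIntegral_ball_eq_lintegral_sphere μ (by fun_prop)]
  refine lintegral_congr fun θ => setLIntegral_congr_fun measurableSet_Ioo fun r hr => ?_
  have h : ‖r • (θ : E)‖ = r := by simp [norm_smul, abs_of_pos hr.1]
  simp only [h]
  have hp : 0 < r ^ (Module.finrank ℝ E - 1) := pow_pos hr.1 _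
  rw [mul_comm (F _), ← mul_assoc, ENNReal.mul_inv_cancel (by simpa using hp) (by simp), one_mul]

theorem setLIntegral_ball_inv_norm_pow (μ : Measure E) [μ.IsAddHaarMeasure] (R : ℝ) :
    ∫⁻ x in ball (0 : E) R, (ENNReal.ofReal (‖x‖ ^ (Module.finrank ℝ E - 1)))⁻¹ ∂μ =
      ENNReal.ofReal R * μ.toSphere univ := by
  simpa using setLIntegral_ball_mul_inv_norm_pow μ (F := fun _ => 1) measurable_const R

theorem setLIntegral_annulus_inv_norm_pow (μ : Measure E) [μ.IsAddHaarMeasure] {δ R : ℝ}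
    (hδ : 0 < δ) (hR : δ ≤ R) :
    ∫⁻ x in ball (0 : E) R \ ball 0 δ, (ENNReal.ofReal (‖x‖ ^ Module.finrank ℝ E))⁻¹ ∂μ =
      ENNReal.ofReal (Real.log (R / δ)) * μ.toSphere univ := by
  have hm : MeasurableSet (ball (0 : E) δ)ᶜ := measurableSet_ball.compl
  have h1 : ∫⁻ x in ball (0 : E) R \ ball 0 δ,
      (ENNReal.ofReal (‖x‖ ^ Module.finrank ℝ E))⁻¹ ∂μ =
      ∫⁻ x in ball (0 : E) R, (ball (0 : E) δ)ᶜ.indicator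
        (fun x => (ENNReal.ofReal (‖x‖ ^ Module.finrank ℝ E))⁻¹) x ∂μ := by
    rw [lintegral_indicator hm, Measure.restrict_restrict hm, Set.inter_comm]
    rfl
  rw [h1, setLIntegral_ball_eq_lintegral_sphere μ (Measurable.indicator (by fun_prop) hm)]
  have h2 : ∀ θ : sphere (0 : E) 1, ∫⁻ r in Ioo (0 : ℝ) R,
      ENNReal.ofReal (r ^ (Module.finrank ℝ E - 1)) * (ball (0 : E) δ)ᶜ.indicator
        (fun x => (ENNReal.ofReal (‖x‖ ^ Module.finrank ℝ E))⁻¹) (r • (θ : E)) =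
      ENNReal.ofReal (Real.log (R / δ)) := by
    intro θ
    have h3 : ∀ r ∈ Ioo (0 : ℝ) R, ENNReal.ofReal (r ^ (Module.finrank ℝ E - 1)) *
        (ball (0 : E) δ)ᶜ.indicator
        (fun x => (ENNReal.ofReal (‖x‖ ^ Module.finrank ℝ E))⁻¹) (r • (θ : E)) =
        (Ici δ).indicator (fun r => ENNReal.ofReal r⁻¹) r := by
      intro r hr
      have h : ‖r • (θ : E)‖ = r := by simp [norm_smul, abs_of_pos hr.1]
      by_cases hd : δ ≤ r
      · have hp : 0 < r ^ Module.finrank ℝ E := pow_pos hr.1 _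
        rw [indicator_of_mem (by simp only [mem_compl_iff, mem_ball_zero_iff, h]; linarith),
          indicator_of_mem (by exact hd), h, ← ENNReal.ofReal_inv_of_pos hp,
          ← ENNReal.ofReal_mul (pow_nonneg hr.1.le _)]
        congr 1
        have hd0 : Module.finrank ℝ E = Module.finrank ℝ E - 1 + 1 :=
          (Nat.sub_add_cancel Module.finrank_pos).symm
        have := hr.1.ne'
        nth_rewrite 2 [hd0]
        rw [pow_succ]
        field_simp
      · rw [indicator_of_notMem
            (by simp only [mem_compl_iff, mem_ball_zero_iff, h]; simpa using hd),
          indicator_of_notMem (by exact hd), mul_zero]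
    rw [setLIntegral_congr_fun measurableSet_Ioo h3, lintegral_indicator measurableSet_Ici,
      Measure.restrict_restrict measurableSet_Ici]
    have h4 : Ici δ ∩ Ioo 0 R = Ico δ R := by
      ext r; simp only [mem_inter_iff, mem_Ici, mem_Ioo, mem_Ico]
      exact ⟨fun h => ⟨h.1, h.2.2⟩, fun h => ⟨h.1, hδ.trans_le h.1, h.2⟩⟩
    have h0 : (0 : ℝ) ∉ uIcc δ R := by
      rw [uIcc_of_le hR]; intro h; exact absurd h.1 (not_le.2 hδ)
    rw [h4, Measure.restrict_congr_set Ico_ae_eq_Ioc, ← ofReal_integral_eq_lintegral_ofReal,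
      ← intervalIntegral.integral_of_le hR, integral_inv h0]
    · exact (intervalIntegrable_iff_integrableOn_Ioc_of_le hR).1
        (intervalIntegral.intervalIntegrable_inv (fun r hr h => h0 (h ▸ hr)) continuousOn_id)
    · filter_upwards [ae_restrict_mem measurableSet_Ioc] with r hr
      exact inv_nonneg.2 (hδ.trans hr.1).le
  simp_rw [h2]
  simp

theorem enorm_le_average_add_potential (μ : Measure E) [μ.IsAddHaarMeasure] {v : E → ℝ}
    (hv : ContDiff ℝ 1 v) (x : E) {R : ℝ} (hR : 0 < R) :
    ‖v x‖ₑ ≤ (μ (ball 0 R))⁻¹ * (∫⁻ z in ball 0 R, ‖v (x + z)‖ₑ ∂μ) +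
      (μ.toSphere univ)⁻¹ * ∫⁻ z in ball 0 R, ‖fderiv ℝ v (x + z)‖ₑ *
        (ENNReal.ofReal (‖z‖ ^ (Module.finrank ℝ E - 1)))⁻¹ ∂μ := by
  have hvc := hv.continuous
  have hfc := hv.continuous_fderiv one_ne_zero
  set A : ENNReal := ∫⁻ r in Ioo (0 : ℝ) R, ENNReal.ofReal (r ^ (Module.finrank ℝ E - 1)) with hA
  have hvol : μ (ball 0 R) = A * μ.toSphere univ := by
    have := setLIntegral_ball_eq_lintegral_sphere μ (F := fun _ => 1) measurable_const R
    simpa using this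
  have hS0 : μ.toSphere univ ≠ 0 :=
    Measure.measure_univ_ne_zero.2 μ.toSphere_ne_zero
  have hS1 : μ.toSphere univ ≠ ⊤ := measure_ne_top _ _
  have hB0 : μ (ball 0 R) ≠ 0 := (measure_ball_pos μ 0 hR).ne'
  have hB1 : μ (ball 0 R) ≠ ⊤ := measure_ball_lt_top.ne
  have hA0 : A ≠ 0 := fun h => hB0 (by rw [hvol, h, zero_mul])
  have hA1 : A ≠ ⊤ := fun h => hB1 (by rw [hvol, h, ENNReal.top_mul hS0])
  rw [setLIntegral_ball_mul_inv_norm_pow μ (F := fun z => ‖fderiv ℝ v (x + z)‖ₑ)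
    (Continuous.measurable (by fun_prop)),
    setLIntegral_ball_eq_lintegral_sphere μ (F := fun z => ‖v (x + z)‖ₑ)
    (Continuous.measurable (by fun_prop))]
  set I₁ := ∫⁻ θ, (∫⁻ r in Ioo (0 : ℝ) R,
    ENNReal.ofReal (r ^ (Module.finrank ℝ E - 1)) * ‖v (x + r • (θ : E))‖ₑ) ∂μ.toSphere with hI₁
  set I₂ := ∫⁻ θ, (∫⁻ r in Ioo (0 : ℝ) R, ‖fderiv ℝ v (x + r • (θ : E))‖ₑ) ∂μ.toSphere with hI₂
  have key : μ (ball 0 R) * ‖v x‖ₑ ≤ I₁ + A * I₂ := by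
    rw [hvol, hI₂, ← lintegral_const_mul' _ _ hA1, hI₁, ← lintegral_add_right']
    · rw [mul_right_comm, ← lintegral_const]
      refine lintegral_mono fun θ => ?_
      have hm : Measurable fun r : ℝ => ENNReal.ofReal (r ^ (Module.finrank ℝ E - 1)) := by
        fun_prop
      rw [← lintegral_mul_const _ hm, ← lintegral_mul_const _ hm, ← lintegral_add_left]
      · refine setLIntegral_mono' measurableSet_Ioo fun r hr => ?_
        rw [← mul_add]
        gcongr
        exact enorm_le_enorm_add_lintegral_enorm_fderiv hv x θ (by simp) hr
      · exact hm.mul (Continuous.measurable (by fun_prop))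
    · refine (Measurable.const_mul ?_ _).aemeasurable
      refine Measurable.lintegral_prod_right' (f := fun p : sphere (0 : E) 1 × ℝ =>
        ‖fderiv ℝ v (x + p.2 • (p.1 : E))‖ₑ) ?_
      exact Continuous.measurable (by fun_prop)
  calc ‖v x‖ₑ = (μ (ball 0 R))⁻¹ * (μ (ball 0 R) * ‖v x‖ₑ) := by
        rw [← mul_assoc, ENNReal.inv_mul_cancel hB0 hB1, one_mul]
    _ ≤ (μ (ball 0 R))⁻¹ * (I₁ + A * I₂) := by gcongr
    _ = _ := by
        rw [mul_add, hvol, ENNReal.mul_inv (.inl hA0) (.inl hA1), ← mul_assoc _ A,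
          mul_right_comm A⁻¹ _ A, ENNReal.inv_mul_cancel hA0 hA1, one_mul]

end Polar

section Holder

theorem lintegral_rpow_le_measure_univ_rpow_mul {X : Type*} [MeasurableSpace X] (ν : Measure X)
    {F : X → ENNReal} (hF : AEMeasurable F ν) {p : ℝ} (hp : 1 < p) :
    (∫⁻ x, F x ∂ν) ^ p ≤ ν Set.univ ^ (p - 1) * ∫⁻ x, F x ^ p ∂ν := by
  have hpq := Real.HolderConjugate.conjExponent hp
  have h := ENNReal.lintegral_mul_le_Lp_mul_Lq ν hpq hF (g := fun _ => 1) aemeasurable_const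
  simp only [Pi.mul_apply, mul_one, ENNReal.one_rpow, lintegral_one] at h
  have hp0 : p ≠ 0 := by positivity
  have hp1 : p - 1 ≠ 0 := by linarith
  calc (∫⁻ x, F x ∂ν) ^ p ≤ ((∫⁻ x, F x ^ p ∂ν) ^ (1 / p) *
        ν Set.univ ^ (1 / p.conjExponent)) ^ p := by gcongr
    _ = _ := by
        rw [ENNReal.mul_rpow_of_nonneg _ _ (by positivity), ← ENNReal.rpow_mul,
          ← ENNReal.rpow_mul, one_div_mul_cancel hp0, ENNReal.rpow_one, mul_comm]
        congr 2
        rw [Real.conjExponent]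
        field_simp

end Holder

section Levels

open Set Metric

theorem average_le_of_lintegral_rpow_le {E : Type*} [NormedAddCommGroup E] [NormedSpace ℝ E]
    [FiniteDimensional ℝ E] [MeasurableSpace E] [BorelSpace E] (μ : Measure E) [μ.IsAddHaarMeasure]
    (hE : 2 ≤ Module.finrank ℝ E) {F : E → ENNReal} (hF : Measurable F) {R : ℝ} (hR : 0 < R)
    (hFR : ∫⁻ y, F y ^ (Module.finrank ℝ E : ℝ) ∂μ ≤
      ENNReal.ofReal R ^ (Module.finrank ℝ E : ℝ)) (x : E) :
    (μ (ball 0 R))⁻¹ * (∫⁻ z in ball 0 R, F (x + z) ∂μ) ≤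
      μ (ball 0 1) ^ (-(1 / (Module.finrank ℝ E : ℝ))) := by
  set p : ℝ := (Module.finrank ℝ E : ℝ) with hp
  have hp1 : 1 < p := by rw [hp]; exact_mod_cast (by omega : 1 < Module.finrank ℝ E)
  have hp0 : p ≠ 0 := by positivity
  have h := lintegral_rpow_le_measure_univ_rpow_mul (μ.restrict (ball 0 R))
    (F := fun z => F (x + z)) (by fun_prop) hp1
  have h2 : ∫⁻ z in ball 0 R, F (x + z) ^ p ∂μ ≤ ENNReal.ofReal R ^ p :=
    (setLIntegral_le_lintegral _ _).trans
      ((lintegral_add_left_eq_self (μ := μ) (fun y => F y ^ p) x).trans_le hFR)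
  have hB0 : μ (ball 0 R) ≠ 0 := (measure_ball_pos μ 0 hR).ne'
  have hB1 : μ (ball 0 R) ≠ ⊤ := measure_ball_lt_top.ne
  have hb0 : μ (ball 0 1) ≠ 0 := (measure_ball_pos μ 0 one_pos).ne'
  have hb1 : μ (ball 0 1) ≠ ⊤ := measure_ball_lt_top.ne
  have hvol : μ (ball 0 R) = ENNReal.ofReal R ^ p * μ (ball 0 1) := by
    rw [μ.addHaar_ball_of_pos _ hR, hp, ENNReal.rpow_natCast, ENNReal.ofReal_pow hR.le]
  have hR0 : ENNReal.ofReal R ^ p ≠ 0 := by simp [hR]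
  have hR1 : ENNReal.ofReal R ^ p ≠ ⊤ := by finiteness
  rw [← ENNReal.rpow_le_rpow_iff (z := p) (by positivity), ENNReal.mul_rpow_of_nonneg _ _
    (by positivity), ← ENNReal.rpow_mul, neg_mul, one_div_mul_cancel hp0, ENNReal.rpow_neg_one]
  rw [Measure.restrict_apply_univ] at h
  calc _ ≤ (μ (ball 0 R))⁻¹ ^ p * (μ (ball 0 R) ^ (p - 1) * ENNReal.ofReal R ^ p) := by
        gcongr; exact h.trans (by gcongr)
    _ = (μ (ball 0 R))⁻¹ * ENNReal.ofReal R ^ p := by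
        rw [← mul_assoc, ENNReal.inv_rpow, ← ENNReal.rpow_neg, ← ENNReal.rpow_add _ _ hB0 hB1,
          ← ENNReal.rpow_neg_one]
        congr 2; ring
    _ = (μ (ball 0 1))⁻¹ := by
        rw [hvol, ENNReal.mul_inv (.inl hR0) (.inl hR1), mul_right_comm,
          ENNReal.inv_mul_cancel hR0 hR1, one_mul]
    _ ≤ _ := le_rfl

variable {E : Type*} [NormedAddCommGroup E] [NormedSpace ℝ E] [FiniteDimensional ℝ E]
  [Nontrivial E] [MeasurableSpace E] [BorelSpace E]

theorem annulus_potential_le (μ : Measure E) [μ.IsAddHaarMeasure]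
    (hE : 2 ≤ Module.finrank ℝ E) {F : E → ENNReal} (hF : Measurable F)
    (hF1 : ∫⁻ y, F y ^ (Module.finrank ℝ E : ℝ) ∂μ ≤ 1) {δ R : ℝ} (hδ : 0 < δ) (hR : δ ≤ R)
    (x : E) :
    (μ.toSphere univ)⁻¹ * ∫⁻ z in ball 0 R \ ball 0 δ, F (x + z) *
        (ENNReal.ofReal (‖z‖ ^ (Module.finrank ℝ E - 1)))⁻¹ ∂μ ≤
      μ.toSphere univ ^ (-(1 / (Module.finrank ℝ E : ℝ))) *
        ENNReal.ofReal (Real.log (R / δ)) ^ (1 - 1 / (Module.finrank ℝ E : ℝ)) := by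
  set p : ℝ := (Module.finrank ℝ E : ℝ) with hp
  have hp1 : 1 < p := by rw [hp]; exact_mod_cast (by omega : 1 < Module.finrank ℝ E)
  have hp0 : p ≠ 0 := by positivity
  have hp2 : p - 1 ≠ 0 := by linarith
  have hpq := Real.HolderConjugate.conjExponent hp1
  have h := ENNReal.lintegral_mul_le_Lp_mul_Lq (μ.restrict (ball 0 R \ ball 0 δ)) hpq
    (f := fun z => F (x + z)) (g := fun z => (ENNReal.ofReal (‖z‖ ^ (Module.finrank ℝ E - 1)))⁻¹)
    (by fun_prop) (by fun_prop)
  simp only [Pi.mul_apply] at h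
  have h2 : ∫⁻ z in ball 0 R \ ball 0 δ, F (x + z) ^ p ∂μ ≤ 1 :=
    (setLIntegral_le_lintegral _ _).trans
      ((lintegral_add_left_eq_self (μ := μ) (fun y => F y ^ p) x).trans_le hF1)
  have hk : ∀ z : E, (ENNReal.ofReal (‖z‖ ^ (Module.finrank ℝ E - 1)))⁻¹ ^ p.conjExponent =
      (ENNReal.ofReal (‖z‖ ^ Module.finrank ℝ E))⁻¹ := by
    intro z
    rw [ENNReal.inv_rpow, ENNReal.ofReal_pow (norm_nonneg _), ENNReal.ofReal_pow (norm_nonneg _),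
      ← ENNReal.rpow_natCast, ← ENNReal.rpow_natCast, ← ENNReal.rpow_mul, ← hp,
      Nat.cast_sub (by omega), ← hp, Real.conjExponent]
    congr 2
    push_cast
    field_simp
  simp only [hk] at h
  rw [setLIntegral_annulus_inv_norm_pow μ hδ hR] at h
  have hS0 : μ.toSphere univ ≠ 0 := Measure.measure_univ_ne_zero.2 μ.toSphere_ne_zero
  have hS1 : μ.toSphere univ ≠ ⊤ := measure_ne_top _ _
  have hc : 1 / p.conjExponent = 1 - 1 / p := by
    rw [Real.conjExponent]; field_simp
  have hc0 : 0 ≤ 1 - 1 / p := by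
    rw [sub_nonneg, div_le_one (by positivity)]; exact hp1.le
  rw [hc] at h
  calc _ ≤ (μ.toSphere univ)⁻¹ * (1 ^ (1 / p) *
        (ENNReal.ofReal (Real.log (R / δ)) * μ.toSphere univ) ^ (1 - 1 / p)) := by
        gcongr; exact h.trans (by gcongr)
    _ = _ := by
        rw [ENNReal.one_rpow, one_mul, ENNReal.mul_rpow_of_nonneg _ _ hc0, mul_comm (_ ^ _),
          ← mul_assoc, ← ENNReal.rpow_neg_one, ← ENNReal.rpow_add _ _ hS0 hS1]
        congr 2; ring

theorem measure_one_le_ball_potential_le (μ : Measure E) [μ.IsAddHaarMeasure]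
    (hE : 2 ≤ Module.finrank ℝ E) {F : E → ENNReal} (hF : Measurable F)
    (hF1 : ∫⁻ y, F y ^ (Module.finrank ℝ E : ℝ) ∂μ ≤ 1) {δ : ℝ} (hδ : 0 < δ) :
    μ {x | 1 ≤ (μ.toSphere univ)⁻¹ * ∫⁻ z in ball 0 δ, F (x + z) *
        (ENNReal.ofReal (‖z‖ ^ (Module.finrank ℝ E - 1)))⁻¹ ∂μ} ≤
      ENNReal.ofReal δ ^ (Module.finrank ℝ E : ℝ) := by
  set p : ℝ := (Module.finrank ℝ E : ℝ) with hp
  have hp1 : 1 < p := by rw [hp]; exact_mod_cast (by omega : 1 < Module.finrank ℝ E)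
  have hp0 : p ≠ 0 := by positivity
  set ω := μ.toSphere univ with hω
  have hS0 : ω ≠ 0 := Measure.measure_univ_ne_zero.2 μ.toSphere_ne_zero
  have hS1 : ω ≠ ⊤ := measure_ne_top _ _
  set k : E → ENNReal := fun z => (ENNReal.ofReal (‖z‖ ^ (Module.finrank ℝ E - 1)))⁻¹ with hk
  have hkm : Measurable k := by fun_prop
  set ν := (μ.restrict (ball 0 δ)).withDensity k with hν
  have hνu : ν univ = ENNReal.ofReal δ * ω := by
    rw [hν, withDensity_apply _ .univ, Measure.restrict_univ, hk]
    exact setLIntegral_ball_inv_norm_pow μ δ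
  have : IsFiniteMeasure ν := ⟨by rw [hνu]; finiteness⟩
  have hint : ∀ x, ∫⁻ z in ball 0 δ, F (x + z) * k z ∂μ = ∫⁻ z, F (x + z) ∂ν := by
    intro x
    rw [hν, lintegral_withDensity_eq_lintegral_mul _ hkm (by fun_prop)]
    simp [mul_comm]
  have hW : ∫⁻ x, ∫⁻ z, F (x + z) ^ p ∂ν ∂μ ≤ ENNReal.ofReal δ * ω := by
    rw [lintegral_lintegral_swap (by fun_prop)]
    calc _ ≤ ∫⁻ _, 1 ∂ν := lintegral_mono fun z =>
            (lintegral_add_right_eq_self (μ := μ) (fun y => F y ^ p) z).trans_le hF1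
      _ = _ := by simp [hνu]
  set c : ENNReal := ω⁻¹ ^ p * (ENNReal.ofReal δ * ω) ^ (p - 1) with hc
  have hsub : {x | 1 ≤ ω⁻¹ * ∫⁻ z in ball 0 δ, F (x + z) * k z ∂μ} ⊆
      {x | 1 ≤ c * ∫⁻ z, F (x + z) ^ p ∂ν} := by
    intro x hx
    simp only [mem_ofPred_eq, hint] at hx ⊢
    have h := lintegral_rpow_le_measure_univ_rpow_mul ν (F := fun z => F (x + z)) (by fun_prop) hp1
    calc (1 : ENNReal) ≤ (ω⁻¹ * ∫⁻ z, F (x + z) ∂ν) ^ p := by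
          simpa using ENNReal.rpow_le_rpow hx (by positivity : 0 ≤ p)
      _ = ω⁻¹ ^ p * (∫⁻ z, F (x + z) ∂ν) ^ p := ENNReal.mul_rpow_of_nonneg _ _ (by positivity)
      _ ≤ ω⁻¹ ^ p * (ν univ ^ (p - 1) * ∫⁻ z, F (x + z) ^ p ∂ν) := by gcongr
      _ = _ := by rw [hνu, hc, mul_assoc]
  have hmW : Measurable fun x => ∫⁻ z, F (x + z) ^ p ∂ν :=
    Measurable.lintegral_prod_right' (f := fun q : E × E => F (q.1 + q.2) ^ p) (by fun_prop)
  calc _ ≤ μ {x | 1 ≤ c * ∫⁻ z, F (x + z) ^ p ∂ν} := measure_mono hsub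
    _ ≤ ∫⁻ x, c * ∫⁻ z, F (x + z) ^ p ∂ν ∂μ := by
        simpa using mul_meas_ge_le_lintegral (μ := μ) (hmW.const_mul c) 1
    _ = c * ∫⁻ x, ∫⁻ z, F (x + z) ^ p ∂ν ∂μ := lintegral_const_mul _ hmW
    _ ≤ c * (ENNReal.ofReal δ * ω) := by gcongr
    _ = ENNReal.ofReal δ ^ p := by
        have hd0 : ENNReal.ofReal δ ≠ 0 := by simpa using hδ
        have h0 : ENNReal.ofReal δ * ω ≠ 0 := mul_ne_zero hd0 hS0
        have h1 : ENNReal.ofReal δ * ω ≠ ⊤ := by finiteness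
        have h2 : (ENNReal.ofReal δ * ω) ^ (p - 1) * (ENNReal.ofReal δ * ω) =
            (ENNReal.ofReal δ * ω) ^ p := by
          nth_rewrite 2 [← ENNReal.rpow_one (ENNReal.ofReal δ * ω)]
          rw [← ENNReal.rpow_add _ _ h0 h1]
          congr 1; ring
        rw [hc, mul_assoc, h2, ← ENNReal.mul_rpow_of_nonneg _ _ (by positivity),
          mul_comm (ENNReal.ofReal δ), ← mul_assoc, ENNReal.inv_mul_cancel hS0 hS1, one_mul]

theorem measure_lt_enorm_le (μ : Measure E) [μ.IsAddHaarMeasure]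
    (hE : 2 ≤ Module.finrank ℝ E) {v : E → ℝ} (hv : ContDiff ℝ 1 v) {δ R : ℝ} (hδ : 0 < δ)
    (hR : δ ≤ R)
    (hvR : ∫⁻ y, ‖v y‖ₑ ^ (Module.finrank ℝ E : ℝ) ∂μ ≤
      ENNReal.ofReal R ^ (Module.finrank ℝ E : ℝ))
    (hv1 : ∫⁻ y, ‖fderiv ℝ v y‖ₑ ^ (Module.finrank ℝ E : ℝ) ∂μ ≤ 1) :
    μ {x | μ (ball 0 1) ^ (-(1 / (Module.finrank ℝ E : ℝ))) + 1 +
        μ.toSphere univ ^ (-(1 / (Module.finrank ℝ E : ℝ))) *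
        ENNReal.ofReal (Real.log (R / δ)) ^ (1 - 1 / (Module.finrank ℝ E : ℝ)) < ‖v x‖ₑ} ≤
      ENNReal.ofReal δ ^ (Module.finrank ℝ E : ℝ) := by
  have hvc := hv.continuous
  have hfm : Measurable fun y => ‖fderiv ℝ v y‖ₑ :=
    (hv.continuous_fderiv one_ne_zero).enorm.measurable
  refine (measure_mono ?_).trans (measure_one_le_ball_potential_le μ hE hfm hv1 hδ)
  intro x hx
  simp only [mem_ofPred_eq] at hx ⊢
  by_contra! hlt
  refine absurd hx (not_lt.2 ?_)
  refine (enorm_le_average_add_potential μ hv x (hδ.trans_le hR)).trans ?_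
  have h1 := average_le_of_lintegral_rpow_le μ hE (F := fun y => ‖v y‖ₑ) hvc.enorm.measurable
    (hδ.trans_le hR) hvR x
  have h2 := annulus_potential_le μ hE hfm hv1 hδ hR x
  have h3 := lintegral_union (μ := μ) (f := fun z => ‖fderiv ℝ v (x + z)‖ₑ *
    (ENNReal.ofReal (‖z‖ ^ (Module.finrank ℝ E - 1)))⁻¹)
    (measurableSet_ball.diff measurableSet_ball)
    (disjoint_sdiff_right : Disjoint (ball (0 : E) δ) (ball 0 R \ ball 0 δ))
  rw [union_sdiff_cancel (ball_subset_ball hR)] at h3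
  rw [h3, mul_add, ← add_assoc]
  exact add_le_add (add_le_add h1 hlt.le) h2

end Levels

section Summation

open Filter Topology Set

theorem lintegral_ofReal_comp_le_of_measure_lt_le {X : Type*} [MeasurableSpace X] (μ : Measure X)
    {h : X → ℝ} (hm : Measurable h) (h0 : ∀ x, 0 ≤ h x) {G W : ℝ → ℝ} {s e : ℕ → ℝ} {M : ENNReal}
    {K : ℝ} (hs : Tendsto s atTop atTop) (hG : MonotoneOn G (Ici 0))
    (hW : Measurable W) (hG0 : ∀ t, 0 ≤ t → 0 ≤ G t)
    (hGW : ∀ t, 0 ≤ t → t ≤ s 0 → G t ≤ K * W t) (hK : 0 ≤ K)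
    (hμ : ∀ k, μ {x | s k < h x} ≤ M * ENNReal.ofReal (e k))
    (hsum : Summable fun k => G (s (k + 1)) * e k) (hs0 : ∀ k, 0 ≤ s k) (he : ∀ k, 0 ≤ e k) :
    ∫⁻ x, ENNReal.ofReal (G (h x)) ∂μ ≤ ENNReal.ofReal K * ∫⁻ x, ENNReal.ofReal (W (h x)) ∂μ +
      M * ENNReal.ofReal (∑' k, G (s (k + 1)) * e k) := by
  have hset : ∀ k, MeasurableSet {x | s k < h x} := fun k => measurableSet_lt measurable_const hm
  have hpt : ∀ x, ENNReal.ofReal (G (h x)) ≤ ENNReal.ofReal K * ENNReal.ofReal (W (h x)) +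
      ∑' k, {x | s k < h x}.indicator (fun _ => ENNReal.ofReal (G (s (k + 1)))) x := by
    intro x
    by_cases hx : h x ≤ s 0
    · refine le_add_right ?_
      rw [← ENNReal.ofReal_mul hK]
      exact ENNReal.ofReal_le_ofReal (hGW _ (h0 x) hx)
    · have hex : ∃ k, h x ≤ s k := (hs.eventually_ge_atTop (h x)).exists
      obtain ⟨k, hk⟩ : ∃ k, Nat.find hex = k + 1 :=
        Nat.exists_eq_succ_of_ne_zero fun h' => hx (h' ▸ Nat.find_spec hex)
      have h1 : h x ≤ s (k + 1) := hk ▸ Nat.find_spec hex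
      have h2 : s k < h x := not_le.1 (Nat.find_min hex (by omega))
      refine le_add_left ((ENNReal.ofReal_le_ofReal (hG (h0 x) (hs0 (k + 1)) h1)).trans ?_)
      refine le_trans ?_ (ENNReal.le_tsum k)
      rw [indicator_of_mem (by exact h2)]
  calc _ ≤ ∫⁻ x, (ENNReal.ofReal K * ENNReal.ofReal (W (h x)) +
      ∑' k, {x | s k < h x}.indicator (fun _ => ENNReal.ofReal (G (s (k + 1)))) x) ∂μ :=
        lintegral_mono hpt
    _ = ENNReal.ofReal K * ∫⁻ x, ENNReal.ofReal (W (h x)) ∂μ +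
        ∑' k, ENNReal.ofReal (G (s (k + 1))) * μ {x | s k < h x} := by
        rw [lintegral_add_left (by fun_prop), lintegral_const_mul _ (by fun_prop),
          lintegral_tsum fun k => (measurable_const.indicator (hset k)).aemeasurable]
        simp only [lintegral_indicator_const (hset _)]
    _ ≤ ENNReal.ofReal K * ∫⁻ x, ENNReal.ofReal (W (h x)) ∂μ +
        ∑' k, M * ENNReal.ofReal (G (s (k + 1)) * e k) := by
        refine add_le_add le_rfl (ENNReal.tsum_le_tsum fun k => ?_)
        rw [ENNReal.ofReal_mul (hG0 _ (hs0 _)), mul_left_comm]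
        gcongr
        exact hμ k
    _ = _ := by
        rw [ENNReal.tsum_mul_left, ENNReal.ofReal_tsum_of_nonneg
          (fun k => mul_nonneg (hG0 _ (hs0 _)) (he k)) hsum]

theorem summable_exp_mul_rpow_levels {N : ℕ} (hN : 2 ≤ N) {α c κ : ℝ} (hα : 0 ≤ α) (hc : 0 ≤ c)
    (hκ : 0 < κ) (hακ : α * κ ^ ((N : ℝ) / ((N : ℝ) - 1)) < N) :
    Summable fun k : ℕ =>
      Real.exp (α * (c + κ * ((k + 1 : ℕ) : ℝ) ^ (1 - 1 / (N : ℝ))) ^ ((N : ℝ) / ((N : ℝ) - 1))) *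
        (c + κ * ((k + 1 : ℕ) : ℝ) ^ (1 - 1 / (N : ℝ))) ^ (N : ℝ) * Real.exp (-(N * k)) := by
  have hN2 : (2 : ℝ) ≤ N := by exact_mod_cast hN
  have hN1 : 0 < (N : ℝ) - 1 := by linarith
  set q : ℝ := (N : ℝ) / ((N : ℝ) - 1) with hq
  have hq0 : 0 < q := by positivity
  set a : ℝ := 1 - 1 / (N : ℝ) with ha
  have ha' : a = ((N : ℝ) - 1) / N := by rw [ha]; field_simp
  have ha0 : 0 < a := by rw [ha']; positivity
  have ha1 : a ≤ 1 := by rw [ha]; simp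
  have haq : a * q = 1 := by rw [ha', hq]; field_simp
  have haN : a * N = ((N - 1 : ℕ) : ℝ) := by
    rw [ha', Nat.cast_sub (by omega)]; field_simp; simp
  obtain ⟨β, hβκ, hβ⟩ : ∃ β, κ < β ∧ α * β ^ q < N := by
    have hcont : ContinuousAt (fun β : ℝ => α * β ^ q) κ :=
      continuousAt_const.mul (Real.continuousAt_rpow_const _ _ (Or.inr hq0.le))
    have h1 : ∀ᶠ β in 𝓝[>] κ, α * β ^ q < N :=
      (hcont.eventually_lt_const hακ).filter_mono nhdsWithin_le_nhds
    obtain ⟨β, h2, h3⟩ := (h1.and self_mem_nhdsWithin).exists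
    exact ⟨β, h3, h2⟩
  have hβ0 : 0 < β := hκ.trans hβκ
  have hlev : ∀ᶠ k : ℕ in atTop, c + κ * ((k + 1 : ℕ) : ℝ) ^ a ≤ β * (k : ℝ) ^ a := by
    have h1 : Tendsto (fun k : ℕ => (β - κ) * (k : ℝ) ^ a) atTop atTop :=
      ((tendsto_rpow_atTop ha0).comp tendsto_natCast_atTop_atTop).const_mul_atTop (by linarith)
    filter_upwards [h1.eventually_ge_atTop (c + κ)] with k hk
    have h2 : ((k + 1 : ℕ) : ℝ) ^ a ≤ (k : ℝ) ^ a + 1 := by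
      have := Real.rpow_add_le_add_rpow (Nat.cast_nonneg (α := ℝ) k) zero_le_one ha0.le ha1
      simpa using this
    nlinarith
  have hsum : Summable fun k : ℕ =>
      β ^ (N : ℝ) * ((k : ℝ) ^ (N - 1) * Real.exp (-(N - α * β ^ q) * k)) :=
    (Real.summable_pow_mul_exp_neg_nat_mul (N - 1) (by linarith)).mul_left _
  refine Summable.of_norm_bounded_eventually_nat hsum ?_
  filter_upwards [hlev] with k hk
  have hs0 : 0 ≤ c + κ * ((k + 1 : ℕ) : ℝ) ^ a := by positivity
  rw [Real.norm_of_nonneg (by positivity)]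
  have hk0 : (0 : ℝ) ≤ k := Nat.cast_nonneg k
  calc _ ≤ Real.exp (α * (β * (k : ℝ) ^ a) ^ q) * (β * (k : ℝ) ^ a) ^ (N : ℝ) *
        Real.exp (-(N * k)) := by gcongr
    _ = Real.exp (α * (β ^ q * k)) * (β ^ (N : ℝ) * (k : ℝ) ^ (N - 1)) * Real.exp (-(N * k)) := by
        rw [Real.mul_rpow hβ0.le (by positivity), Real.mul_rpow hβ0.le (by positivity),
          ← Real.rpow_mul hk0, ← Real.rpow_mul hk0, haq, haN, Real.rpow_one,
          Real.rpow_natCast (k : ℝ)]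
    _ = β ^ (N : ℝ) * ((k : ℝ) ^ (N - 1) * (Real.exp (α * (β ^ q * k)) * Real.exp (-(N * k)))) := by
        ring
    _ = _ := by rw [← Real.exp_add]; congr 3; ring

end Summation

section Smooth

open Set Metric Filter

variable {E : Type*} [NormedAddCommGroup E] [NormedSpace ℝ E] [FiniteDimensional ℝ E]
  [Nontrivial E] [MeasurableSpace E] [BorelSpace E]

theorem exists_lintegral_exp_mul_rpow_le_of_contDiff (μ : Measure E) [μ.IsAddHaarMeasure]
    {N : ℕ} (hNE : Module.finrank ℝ E = N) (hN : 2 ≤ N) {α : ℝ} (hα0 : 0 < α)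
    (hα : α < (N : ℝ) * μ.toSphere.real univ ^ (1 / ((N : ℝ) - 1))) :
    ∃ C : ℝ, 0 < C ∧ ∀ (R : ℝ) (v : E → ℝ), 0 < R → ContDiff ℝ 1 v →
      ∫⁻ y, ‖v y‖ₑ ^ (N : ℝ) ∂μ ≤ ENNReal.ofReal R ^ (N : ℝ) →
      ∫⁻ y, ‖fderiv ℝ v y‖ₑ ^ (N : ℝ) ∂μ ≤ 1 →
      ∫⁻ y, ENNReal.ofReal
        (Real.exp (α * |v y| ^ ((N : ℝ) / ((N : ℝ) - 1))) * |v y| ^ (N : ℝ)) ∂μ ≤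
        ENNReal.ofReal C * ENNReal.ofReal R ^ (N : ℝ) := by
  have hN2 : (2 : ℝ) ≤ N := by exact_mod_cast hN
  have hN1 : 0 < (N : ℝ) - 1 := by linarith
  set q : ℝ := (N : ℝ) / ((N : ℝ) - 1) with hq
  have hq0 : 0 < q := by positivity
  set ω := μ.toSphere.real univ with hω
  have hS0 : μ.toSphere univ ≠ 0 := Measure.measure_univ_ne_zero.2 μ.toSphere_ne_zero
  have hω0 : 0 < ω := ENNReal.toReal_pos hS0 (measure_ne_top _ _)
  have hb0 : 0 < μ.real (ball 0 1) :=
    ENNReal.toReal_pos (measure_ball_pos μ 0 one_pos).ne' measure_ball_lt_top.ne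
  set c : ℝ := μ.real (ball 0 1) ^ (-(1 / (N : ℝ))) + 1 with hc
  have hc0 : 0 ≤ c := by positivity
  set κ : ℝ := ω ^ (-(1 / (N : ℝ))) with hκ
  have hκ0 : 0 < κ := by positivity
  set a : ℝ := 1 - 1 / (N : ℝ) with ha
  have ha0 : 0 < a := by
    rw [ha, sub_pos, div_lt_one (by positivity)]; linarith
  have hακ : α * κ ^ q < N := by
    have h1 : κ ^ q = (ω ^ (1 / ((N : ℝ) - 1)))⁻¹ := by
      rw [hκ, ← Real.rpow_mul hω0.le, ← Real.rpow_neg hω0.le]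
      congr 1
      rw [hq]; field_simp
    rw [h1, ← div_eq_mul_inv, div_lt_iff₀ (by positivity)]
    exact hα
  set s : ℕ → ℝ := fun k => c + κ * (k : ℝ) ^ a with hs
  have hs0 : ∀ k, 0 ≤ s k := fun k => by positivity
  set G : ℝ → ℝ := fun t => Real.exp (α * t ^ q) * t ^ (N : ℝ) with hG
  have hsum : Summable fun k => G (s (k + 1)) * Real.exp (-(N * k)) :=
    summable_exp_mul_rpow_levels hN hα0.le hc0 hκ0 hακ
  set T : ℝ := ∑' k, G (s (k + 1)) * Real.exp (-(N * k)) with hT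
  have hG0 : ∀ t, 0 ≤ t → 0 ≤ G t := fun t ht => by positivity
  have hT0 : 0 ≤ T := tsum_nonneg fun k => mul_nonneg (hG0 _ (hs0 _)) (Real.exp_nonneg _)
  refine ⟨Real.exp (α * s 0 ^ q) + T, by positivity, fun R v hR hv hvR hv1 => ?_⟩
  have hlev : ∀ k : ℕ, μ {x | s k < |v x|} ≤
      ENNReal.ofReal R ^ (N : ℝ) * ENNReal.ofReal (Real.exp (-(N * k))) := by
    intro k
    have hδ : 0 < R * Real.exp (-k) := by positivity
    have hδR : R * Real.exp (-k) ≤ R :=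
      mul_le_of_le_one_right hR.le (Real.exp_le_one_iff.2 (by simp))
    have h := measure_lt_enorm_le μ (by rw [hNE]; exact hN) hv hδ hδR (by rwa [hNE])
      (by rwa [hNE])
    have hlog : Real.log (R / (R * Real.exp (-k))) = k := by
      rw [div_mul_eq_div_div, div_self hR.ne', one_div, ← Real.exp_neg, Real.log_exp, neg_neg]
    have hsk : ENNReal.ofReal (s k) = μ (ball 0 1) ^ (-(1 / (N : ℝ))) + 1 +
        μ.toSphere univ ^ (-(1 / (N : ℝ))) * ENNReal.ofReal (k : ℝ) ^ (1 - 1 / (N : ℝ)) := by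
      simp only [hs]
      rw [ENNReal.ofReal_add hc0 (by positivity), hc, ENNReal.ofReal_add (by positivity) (by simp),
        ENNReal.ofReal_mul hκ0.le, hκ, ← ENNReal.ofReal_rpow_of_pos hb0,
        ← ENNReal.ofReal_rpow_of_pos hω0, ENNReal.ofReal_rpow_of_nonneg (by simp) ha0.le,
        hω, ofReal_measureReal, ofReal_measureReal, ENNReal.ofReal_one]
    rw [hNE, hlog, ← hsk] at h
    calc _ ≤ _ := measure_mono fun x hx => ?_
      _ ≤ _ := h
      _ = _ := ?_
    · simp only [mem_ofPred_eq] at hx ⊢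
      rw [Real.enorm_eq_ofReal_abs]
      exact (ENNReal.ofReal_lt_ofReal_iff_of_nonneg (hs0 k)).2 hx
    · rw [ENNReal.ofReal_mul hR.le, ENNReal.mul_rpow_of_nonneg _ _ (by positivity),
        ENNReal.ofReal_rpow_of_pos (Real.exp_pos _), ← Real.exp_mul]
      congr 3; ring
  have hst : Tendsto s atTop atTop :=
    tendsto_atTop_add_const_left _ _
      (((tendsto_rpow_atTop ha0).comp tendsto_natCast_atTop_atTop).const_mul_atTop hκ0)
  have hGm : MonotoneOn G (Ici 0) := by
    intro x hx y hy hxy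
    have hx' : (0 : ℝ) ≤ x := hx
    simp only [hG]
    gcongr
  have hmain := lintegral_ofReal_comp_le_of_measure_lt_le μ (h := fun x => |v x|)
    (G := G) (W := fun t => t ^ (N : ℝ)) (K := Real.exp (α * s 0 ^ q))
    hv.continuous.abs.measurable (fun x => abs_nonneg _) hst hGm (by fun_prop) hG0
    (fun t ht hts => by simp only [hG]; gcongr) (Real.exp_nonneg _) hlev hsum hs0
    (fun k => Real.exp_nonneg _)
  have hW : ∀ x, ENNReal.ofReal (|v x| ^ (N : ℝ)) = ‖v x‖ₑ ^ (N : ℝ) := fun x => by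
    rw [Real.enorm_eq_ofReal_abs, ENNReal.ofReal_rpow_of_nonneg (abs_nonneg _) (by positivity)]
  simp only [hW] at hmain
  calc _ ≤ _ := hmain
    _ ≤ ENNReal.ofReal (Real.exp (α * s 0 ^ q)) * ENNReal.ofReal R ^ (N : ℝ) +
        ENNReal.ofReal R ^ (N : ℝ) * ENNReal.ofReal T := by gcongr
    _ = _ := by
        rw [ENNReal.ofReal_add (Real.exp_nonneg _) hT0]; ring

end Smooth

section Mollification

open Filter Topology ContinuousLinearMap
open scoped Convolution

theorem lintegral_enorm_normed_convolution_rpow_le {E F : Type*} [NormedAddCommGroup E]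
    [NormedSpace ℝ E] [FiniteDimensional ℝ E] [MeasurableSpace E] [BorelSpace E]
    [NormedAddCommGroup F] [NormedSpace ℝ F] (μ : Measure E) [μ.IsAddHaarMeasure]
    (φ : ContDiffBump (0 : E)) {w : E → F} (hw : AEStronglyMeasurable w μ) {p : ℝ} (hp : 1 < p) :
    ∫⁻ x, ‖(φ.normed μ ⋆[lsmul ℝ ℝ, μ] w) x‖ₑ ^ p ∂μ ≤ ∫⁻ x, ‖w x‖ₑ ^ p ∂μ := by
  have hρm : Measurable fun t => ENNReal.ofReal (φ.normed μ t) :=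
    φ.continuous_normed.measurable.ennreal_ofReal
  set ν := μ.withDensity fun t => ENNReal.ofReal (φ.normed μ t) with hν
  have hνac : ν ≪ μ := withDensity_absolutelyContinuous _ _
  have hν1 : ν Set.univ = 1 := by
    rw [hν, withDensity_apply _ .univ, Measure.restrict_univ,
      ← ofReal_integral_eq_lintegral_ofReal φ.integrable_normed (ae_of_all _ φ.nonneg_normed),
      φ.integral_normed, ENNReal.ofReal_one]
  have : IsProbabilityMeasure ν := ⟨hν1⟩
  have hqmp : ∀ x : E, Measure.QuasiMeasurePreserving (fun t => x - t) μ μ := fun x =>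
    quasiMeasurePreserving_sub_left μ x
  have hwx : ∀ x, AEMeasurable (fun t => ‖w (x - t)‖ₑ) μ := fun x =>
    (hw.comp_quasiMeasurePreserving (hqmp x)).enorm
  have hprod : AEMeasurable (fun z : E × E => ‖w (z.1 - z.2)‖ₑ ^ p) (μ.prod ν) := by
    have h1 : AEStronglyMeasurable (fun z : E × E => w (z.1 - z.2)) (μ.prod μ) :=
      hw.comp_quasiMeasurePreserving (quasiMeasurePreserving_sub_of_right_invariant μ μ)
    exact (h1.mono_ac (Measure.AbsolutelyContinuous.rfl.prod hνac)).enorm.pow_const p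
  calc _ ≤ ∫⁻ x, ∫⁻ t, ‖w (x - t)‖ₑ ^ p ∂ν ∂μ := by
        refine lintegral_mono fun x => ?_
        have h1 : ‖(φ.normed μ ⋆[lsmul ℝ ℝ, μ] w) x‖ₑ ≤ ∫⁻ t, ‖w (x - t)‖ₑ ∂ν := by
          rw [convolution_lsmul, hν, lintegral_withDensity_eq_lintegral_mul₀ hρm.aemeasurable
            (hwx x)]
          refine (enorm_integral_le_lintegral_enorm _).trans_eq (lintegral_congr fun t => ?_)
          rw [enorm_smul, Real.enorm_of_nonneg (φ.nonneg_normed t)]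
          rfl
        have h2 := lintegral_rpow_le_measure_univ_rpow_mul ν ((hwx x).mono_ac hνac) hp
        rw [hν1, ENNReal.one_rpow, one_mul] at h2
        exact (ENNReal.rpow_le_rpow h1 (by linarith)).trans h2
    _ = ∫⁻ t, ∫⁻ x, ‖w (x - t)‖ₑ ^ p ∂μ ∂ν := lintegral_lintegral_swap hprod
    _ = ∫⁻ t, ∫⁻ x, ‖w x‖ₑ ^ p ∂μ ∂ν :=
        lintegral_congr fun t => lintegral_sub_right_eq_self (fun x => ‖w x‖ₑ ^ p) t
    _ = _ := by simp

theorem HasWeakGradient.fderiv_convolution {N : ℕ} {u : EuclideanSpace ℝ (Fin N) → ℝ}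
    {g : EuclideanSpace ℝ (Fin N) → EuclideanSpace ℝ (Fin N)} (h : HasWeakGradient u g)
    {ρ : EuclideanSpace ℝ (Fin N) → ℝ} (hρ : ContDiff ℝ (⊤ : ℕ∞) ρ) (hρc : HasCompactSupport ρ)
    (x : EuclideanSpace ℝ (Fin N)) :
    fderiv ℝ (ρ ⋆[lsmul ℝ ℝ, volume] u) x =
      innerSL ℝ ((ρ ⋆[lsmul ℝ ℝ, volume] g) x) := by
  obtain ⟨hu, hg, hug⟩ := h
  have hρ1 : ContDiff ℝ 1 ρ := hρ.of_le (by exact_mod_cast le_top)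
  rw [(hρc.hasFDerivAt_convolution_left (lsmul ℝ ℝ) hρ1 hu x).fderiv]
  have hbasis : ∀ i : Fin N, ((fderiv ℝ ρ ⋆[(lsmul ℝ ℝ).precompL (EuclideanSpace ℝ (Fin N)),
      volume] u) x) (EuclideanSpace.single i 1) =
      innerSL ℝ ((ρ ⋆[lsmul ℝ ℝ, volume] g) x) (EuclideanSpace.single i 1) := by
    intro i
    have hex : ConvolutionExistsAt (fderiv ℝ ρ) u x
        ((lsmul ℝ ℝ).precompL (EuclideanSpace ℝ (Fin N))) volume :=
      (hρc.fderiv ℝ).convolutionExists_left _ (hρ1.continuous_fderiv one_ne_zero) hu x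
    have hexg : ConvolutionExistsAt ρ g x (lsmul ℝ ℝ) volume :=
      hρc.convolutionExists_left _ hρ1.continuous hg x
    have hL : ((fderiv ℝ ρ ⋆[(lsmul ℝ ℝ).precompL (EuclideanSpace ℝ (Fin N)),
        volume] u) x) (EuclideanSpace.single i 1) =
        ∫ y, u y * fderiv ℝ ρ (x - y) (EuclideanSpace.single i 1) := by
      rw [convolution_def, ContinuousLinearMap.integral_apply hex]
      rw [← integral_sub_left_eq_self _ volume x]
      refine integral_congr_ae (ae_of_all _ fun y => ?_)
      simp [ContinuousLinearMap.precompL_apply, mul_comm]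
    have hR : innerSL ℝ ((ρ ⋆[lsmul ℝ ℝ, volume] g) x) (EuclideanSpace.single i 1) =
        ∫ y, g y i * ρ (x - y) := by
      have h1 : innerSL ℝ ((ρ ⋆[lsmul ℝ ℝ, volume] g) x) (EuclideanSpace.single i 1) =
          EuclideanSpace.proj (𝕜 := ℝ) i ((ρ ⋆[lsmul ℝ ℝ, volume] g) x) := by
        simp [EuclideanSpace.inner_single_right]
      rw [h1, convolution_def, ← ContinuousLinearMap.integral_comp_comm _ hexg]
      rw [← integral_sub_left_eq_self _ volume x]
      refine integral_congr_ae (ae_of_all _ fun y => ?_)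
      simp [mul_comm]
    have ht := hug (fun y => ρ (x - y)) (hρ.comp (contDiff_const.sub contDiff_id))
      (hρc.comp_homeomorph (Homeomorph.subLeft x)) i
    have hf : ∀ y, fderiv ℝ (fun y => ρ (x - y)) y = - fderiv ℝ ρ (x - y) := by
      intro y
      have h1 := ((hρ1.differentiable one_ne_zero (x - y)).hasFDerivAt.comp y
        ((hasFDerivAt_id y).const_sub x)).fderiv
      refine h1.trans ?_
      ext z
      simp
    simp only [hf, _root_.neg_apply, mul_neg, integral_neg, neg_inj] at ht
    rw [hL, hR, ht]
  refine ContinuousLinearMap.coe_injective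
    ((EuclideanSpace.basisFun (Fin N) ℝ).toBasis.ext fun i => ?_)
  simpa using hbasis i

end Mollification

/-- **Lemma 3.1.** For `N ≥ 2` and `0 < α < α_N = N·ω_{N-1}^{1/(N-1)}`, there is `C_α > 0`
such that for every `u ∈ W^{1,N}(ℝ^N)` with `∫|∇u|^N ≤ 1`,
`∫ e^{α|u|^{N/(N-1)}}|u|^N dx ≤ C_α ∫ |u|^N dx`. -/
theorem moser_trudinger_exp_nonsingular (N : ℕ) (hN : 2 ≤ N) (α : ℝ) (hα0 : 0 < α)
    (hα : α < (N : ℝ) * sphereArea N ^ (1 / ((N : ℝ) - 1))) :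
    ∃ C : ℝ, 0 < C ∧
      ∀ (u : EuclideanSpace ℝ (Fin N) → ℝ)
        (g : EuclideanSpace ℝ (Fin N) → EuclideanSpace ℝ (Fin N)),
        HasWeakGradient u g →
        (∫⁻ x, ENNReal.ofReal (|u x| ^ (N : ℝ))) ≠ ⊤ →
        (∫⁻ x, ENNReal.ofReal (‖g x‖ ^ (N : ℝ))) ≤ 1 →
        (∫⁻ x, ENNReal.ofReal
            (Real.exp (α * |u x| ^ ((N : ℝ) / ((N : ℝ) - 1))) * |u x| ^ (N : ℝ)))
          ≤ ENNReal.ofReal C * ∫⁻ x, ENNReal.ofReal (|u x| ^ (N : ℝ)) := by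
  have hN2 : (2 : ℝ) ≤ N := by exact_mod_cast hN
  have hNpos : (0 : ℝ) < N := by linarith
  have hq : 0 ≤ (N : ℝ) / ((N : ℝ) - 1) := div_nonneg hNpos.le (by linarith)
  have : Nonempty (Fin N) := ⟨⟨0, by omega⟩⟩
  have hω : (volume : Measure (EuclideanSpace ℝ (Fin N))).toSphere.real Set.univ =
      sphereArea N := by
    rw [Measure.toSphere_real_apply_univ, finrank_euclideanSpace_fin]
    rfl
  obtain ⟨C, hC, hsmooth⟩ := exists_lintegral_exp_mul_rpow_le_of_contDiff
    (volume : Measure (EuclideanSpace ℝ (Fin N))) finrank_euclideanSpace_fin hN hα0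
    (by rwa [hω])
  refine ⟨C, hC, fun u g hug hufin hg => ?_⟩
  have hu := hug.1
  have hgl := hug.2.1
  have henorm : ∀ {F : Type} [NormedAddCommGroup F] (y : F),
      ENNReal.ofReal (‖y‖ ^ (N : ℝ)) = ‖y‖ₑ ^ (N : ℝ) := fun y => by
    rw [← ofReal_norm, ENNReal.ofReal_rpow_of_nonneg (norm_nonneg _) hNpos.le]
  have hgl1 : ∫⁻ x, ‖g x‖ₑ ^ (N : ℝ) ≤ 1 := by simpa only [henorm] using hg
  have huabs : ∀ x, ENNReal.ofReal (|u x| ^ (N : ℝ)) = ‖u x‖ₑ ^ (N : ℝ) := fun x => henorm (u x)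
  simp only [huabs] at hufin ⊢
  by_cases hzero : ∫⁻ x, ‖u x‖ₑ ^ (N : ℝ) = 0
  · have hae : ∀ᵐ x, ‖u x‖ₑ ^ (N : ℝ) = 0 :=
      (lintegral_eq_zero_iff' (hu.aestronglyMeasurable.enorm.pow_const _)).1 hzero
    refine le_of_eq_of_le ?_ zero_le
    rw [← lintegral_zero (μ := (volume : Measure (EuclideanSpace ℝ (Fin N))))]
    refine lintegral_congr_ae (hae.mono fun x hx => ?_)
    have hux : u x = 0 := by
      rwa [ENNReal.rpow_eq_zero_iff_of_pos hNpos, enorm_eq_zero] at hx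
    simp [hux, zero_pow (by omega : N ≠ 0)]
  set R : ℝ := (∫⁻ x, ‖u x‖ₑ ^ (N : ℝ)).toReal ^ (1 / (N : ℝ)) with hR
  have hR0 : 0 < R := Real.rpow_pos_of_pos (ENNReal.toReal_pos hzero hufin) _
  have hRN : ENNReal.ofReal R ^ (N : ℝ) = ∫⁻ x, ‖u x‖ₑ ^ (N : ℝ) := by
    rw [ENNReal.ofReal_rpow_of_pos hR0, hR, ← Real.rpow_mul ENNReal.toReal_nonneg,
      one_div_mul_cancel hNpos.ne', Real.rpow_one, ENNReal.ofReal_toReal hufin]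
  rw [← hRN]
  let φ : ℕ → ContDiffBump (0 : EuclideanSpace ℝ (Fin N)) := fun n =>
    ⟨1 / ((n : ℝ) + 1), 2 * (1 / ((n : ℝ) + 1)), by positivity, by
      have : 0 < 1 / ((n : ℝ) + 1) := by positivity
      linarith⟩
  let v : ℕ → EuclideanSpace ℝ (Fin N) → ℝ := fun n =>
    convolution ((φ n).normed volume) u (ContinuousLinearMap.lsmul ℝ ℝ) volume
  have hφ : Filter.Tendsto (fun n => (φ n).rOut) Filter.atTop (nhds 0) := by
    simpa [φ] using (tendsto_one_div_add_atTop_nhds_zero_nat (𝕜 := ℝ)).const_mul 2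
  have hlim : ∀ᵐ x, Filter.Tendsto (fun n => v n x) Filter.atTop (nhds (u x)) :=
    ContDiffBump.ae_convolution_tendsto_right_of_locallyIntegrable hφ (K := 2)
      (Filter.Eventually.of_forall fun n => le_rfl) hu
  have hv : ∀ n, ContDiff ℝ 1 (v n) := fun n =>
    (φ n).hasCompactSupport_normed.contDiff_convolution_left (n := 1) _ (φ n).contDiff_normed hu
  have hbound : ∀ n, ∫⁻ y, ENNReal.ofReal
      (Real.exp (α * |v n y| ^ ((N : ℝ) / ((N : ℝ) - 1))) * |v n y| ^ (N : ℝ)) ≤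
      ENNReal.ofReal C * ENNReal.ofReal R ^ (N : ℝ) := by
    intro n
    refine hsmooth R (v n) hR0 (hv n) ?_ ?_
    · rw [hRN]
      exact lintegral_enorm_normed_convolution_rpow_le volume (φ n) hu.aestronglyMeasurable
        (by linarith)
    · refine le_trans (le_of_eq (lintegral_congr fun y => ?_))
        ((lintegral_enorm_normed_convolution_rpow_le volume (φ n) hgl.aestronglyMeasurable
          (by linarith : (1 : ℝ) < N)).trans hgl1)
      rw [hug.fderiv_convolution (φ n).contDiff_normed (φ n).hasCompactSupport_normed y]
      rw [← ofReal_norm, innerSL_apply_norm, ofReal_norm]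
  have hcont : Continuous fun t : ℝ => ENNReal.ofReal
      (Real.exp (α * |t| ^ ((N : ℝ) / ((N : ℝ) - 1))) * |t| ^ (N : ℝ)) := by
    have h1 : Continuous fun t : ℝ => |t| ^ ((N : ℝ) / ((N : ℝ) - 1)) :=
      continuous_abs.rpow_const fun _ => Or.inr hq
    have h2 : Continuous fun t : ℝ => |t| ^ (N : ℝ) :=
      continuous_abs.rpow_const fun _ => Or.inr hNpos.le
    exact ENNReal.continuous_ofReal.comp
      ((Real.continuous_exp.comp (continuous_const.mul h1)).mul h2)
  calc _ = ∫⁻ x, Filter.liminf (fun n => ENNReal.ofReal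
        (Real.exp (α * |v n x| ^ ((N : ℝ) / ((N : ℝ) - 1))) * |v n x| ^ (N : ℝ)))
        Filter.atTop :=
        lintegral_congr_ae (hlim.mono fun x hx =>
          ((hcont.tendsto (u x)).comp hx).liminf_eq.symm)
    _ ≤ Filter.liminf (fun n => ∫⁻ x, ENNReal.ofReal
        (Real.exp (α * |v n x| ^ ((N : ℝ) / ((N : ℝ) - 1))) * |v n x| ^ (N : ℝ)))
        Filter.atTop :=
        lintegral_liminf_le fun n => (hcont.comp (hv n).continuous).measurable
    _ ≤ _ := Filter.liminf_le_of_le (by isBoundedDefault) fun b hb =>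
        (hb.exists).elim fun n hn => hn.trans (hbound n)
end
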